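/- Let p be an odd prime, K a finite extension of ℚ_p with ring of integers O and valuation v_p normalized so that v_p(p) = 1. Let F ∈ O[[T]] be a power series with vanishing μ-invariant and λ-invariant λ(F), let F′ denote its formal derivative, let t₀ ∈ O with v_p(t₀) > 0, and let b ∈ O with v_p(b − t₀) = 1. Then the following three conditions are equivalent: (1) λ(F) > 1; (2) v_p(F(t₀)) > 0 and v_p(F′(t₀)) > 0; (3) v_p(F(t₀)) > 0 and v_p(F(b) − F(t₀)) > 1. -/

import Mathlib

/-- The λ-invariant: least index `j` with `c j` a unit of the ring of integers,
i.e. `‖c j‖ = 1`. -/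
noncomputable def lambdaInvariant {K : Type*} [NormedField K] (c : ℕ → K) : ℕ :=
  sInf {j | ‖c j‖ = 1}

/-- Evaluation `F(x) = Σ_j c_j x^j` of the power series with coefficients `c`. -/
noncomputable def psEval {K : Type*} [NormedField K] [CompleteSpace K]
    (c : ℕ → K) (x : K) : K :=
  ∑' j : ℕ, c j * x ^ j

/-- Evaluation `F'(x) = Σ_j (j+1) c_{j+1} x^j` of the formal derivative. -/
noncomputable def psDerivEval {K : Type*} [NormedField K] [CompleteSpace K]
    (c : ℕ → K) (x : K) : K :=
  ∑' j : ℕ, ((j + 1 : ℕ) : K) * c (j + 1) * x ^ j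

theorem norm_tsum_lt_iff_norm_zero_lt {K : Type*} [NormedField K] [IsUltrametricDist K]
    {f : ℕ → K} (hf : Summable f) {r s : ℝ} (hrs : r < s) (h : ∀ j, ‖f (j + 1)‖ ≤ r) :
    ‖∑' j, f j‖ < s ↔ ‖f 0‖ < s := by
  have hr : 0 ≤ r := (norm_nonneg _).trans (h 0)
  have htail : ‖∑' j, f (j + 1)‖ < s :=
    (IsUltrametricDist.norm_tsum_le_of_forall_le_of_nonneg hr h).trans_lt hrs
  rw [hf.tsum_eq_zero_add]
  constructor
  · intro H
    have := IsUltrametricDist.norm_add_le_max (f 0 + ∑' j, f (j + 1)) (-∑' j, f (j + 1))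
    rw [add_neg_cancel_right, norm_neg] at this
    exact this.trans_lt (max_lt H htail)
  · intro H
    exact (IsUltrametricDist.norm_add_le_max _ _).trans_lt (max_lt H htail)

theorem summable_mul_pow_of_norm_le_one {K : Type*} [NormedField K] [CompleteSpace K]
    {c : ℕ → K} (hc : ∀ j, ‖c j‖ ≤ 1) {x : K} (hx : ‖x‖ < 1) :
    Summable fun j => c j * x ^ j := by
  refine Summable.of_norm_bounded (summable_geometric_of_lt_one (norm_nonneg x) hx) fun j => ?_
  rw [norm_mul, norm_pow]
  exact mul_le_of_le_one_left (by positivity) (hc j)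

theorem norm_mul_pow_succ_le {K : Type*} [NormedField K]
    {a x : K} (ha : ‖a‖ ≤ 1) (hx : ‖x‖ < 1) (j : ℕ) : ‖a * x ^ (j + 1)‖ ≤ ‖x‖ := by
  rw [norm_mul, norm_pow]
  refine (mul_le_of_le_one_left (by positivity) ha).trans ?_
  exact pow_le_of_le_one (norm_nonneg x) hx.le j.succ_ne_zero

theorem norm_pow_sub_pow_le {K : Type*} [NormedField K] [IsUltrametricDist K]
    {x y : K} (hx : ‖x‖ ≤ 1) (hy : ‖y‖ ≤ 1) (n : ℕ) : ‖x ^ n - y ^ n‖ ≤ ‖x - y‖ := by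
  induction n with
  | zero => simp
  | succ n ih =>
    have e : x ^ (n + 1) - y ^ (n + 1) = x ^ n * (x - y) + y * (x ^ n - y ^ n) := by ring
    rw [e]
    refine (IsUltrametricDist.norm_add_le_max _ _).trans (max_le ?_ ?_)
    · rw [norm_mul, norm_pow]
      exact mul_le_of_le_one_left (norm_nonneg _) (pow_le_one₀ (norm_nonneg _) hx)
    · rw [norm_mul]
      exact (mul_le_of_le_one_left (norm_nonneg _) hy).trans ih

theorem norm_pow_add_two_sub_pow_le {K : Type*} [NormedField K] [IsUltrametricDist K]
    {x y : K} (hx : ‖x‖ ≤ 1) (hy : ‖y‖ ≤ 1) (n : ℕ) :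
    ‖x ^ (n + 2) - y ^ (n + 2)‖ ≤ max ‖x‖ ‖y‖ * ‖x - y‖ := by
  have e : x ^ (n + 2) - y ^ (n + 2) =
      x ^ (n + 1) * (x - y) + y * (x ^ (n + 1) - y ^ (n + 1)) := by ring
  rw [e]
  refine (IsUltrametricDist.norm_add_le_max _ _).trans (max_le ?_ ?_)
  · rw [norm_mul, norm_pow]
    gcongr
    exact (pow_le_of_le_one (norm_nonneg x) hx n.succ_ne_zero).trans (le_max_left _ _)
  · rw [norm_mul]
    gcongr
    · exact le_max_right _ _
    · exact norm_pow_sub_pow_le hx hy _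

theorem one_lt_lambdaInvariant_iff {K : Type*} [NormedField K] {c : ℕ → K}
    (hc : ∀ j, ‖c j‖ ≤ 1) (hμ : ∃ j, ‖c j‖ = 1) :
    1 < lambdaInvariant c ↔ ‖c 0‖ < 1 ∧ ‖c 1‖ < 1 := by
  unfold lambdaInvariant
  constructor
  · intro h
    exact ⟨(hc 0).lt_of_ne fun h0 => Nat.notMem_of_lt_sInf (zero_lt_one.trans h) h0,
      (hc 1).lt_of_ne fun h1 => Nat.notMem_of_lt_sInf h h1⟩
  · rintro ⟨h0, h1⟩
    have hmem : ‖c (sInf {j | ‖c j‖ = 1})‖ = 1 := Nat.sInf_mem (s := {j | ‖c j‖ = 1}) hμ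
    by_contra! hle
    interval_cases hj : sInf {j | ‖c j‖ = 1}
    · exact h0.ne hmem
    · exact h1.ne hmem

theorem norm_psEval_lt_one_iff {K : Type*} [NormedField K] [CompleteSpace K]
    [IsUltrametricDist K] {c : ℕ → K} (hc : ∀ j, ‖c j‖ ≤ 1) {x : K} (hx : ‖x‖ < 1) :
    ‖psEval c x‖ < 1 ↔ ‖c 0‖ < 1 := by
  simpa [psEval] using norm_tsum_lt_iff_norm_zero_lt (summable_mul_pow_of_norm_le_one hc hx) hx
    fun j => norm_mul_pow_succ_le (hc (j + 1)) hx j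

theorem norm_psDerivEval_lt_one_iff {K : Type*} [NormedField K] [CompleteSpace K]
    [IsUltrametricDist K] {c : ℕ → K} (hc : ∀ j, ‖c j‖ ≤ 1) {x : K} (hx : ‖x‖ < 1) :
    ‖psDerivEval c x‖ < 1 ↔ ‖c 1‖ < 1 := by
  have hd : ∀ j : ℕ, ‖((j + 1 : ℕ) : K) * c (j + 1)‖ ≤ 1 := fun j => by
    rw [norm_mul]
    exact mul_le_one₀ (IsUltrametricDist.norm_natCast_le_one K _) (norm_nonneg _) (hc _)
  have := norm_tsum_lt_iff_norm_zero_lt (summable_mul_pow_of_norm_le_one hd hx) hx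
    fun j => norm_mul_pow_succ_le (hd (j + 1)) hx j
  rw [psDerivEval, this]
  simp

theorem norm_psEval_sub_lt_iff {K : Type*} [NormedField K] [CompleteSpace K]
    [IsUltrametricDist K] {c : ℕ → K} (hc : ∀ j, ‖c j‖ ≤ 1) {x y : K}
    (hx : ‖x‖ < 1) (hy : ‖y‖ < 1) (hxy : 0 < ‖x - y‖) :
    ‖psEval c x - psEval c y‖ < ‖x - y‖ ↔ ‖c 1‖ < 1 := by
  have hsx := summable_mul_pow_of_norm_le_one hc hx
  have hsy := summable_mul_pow_of_norm_le_one hc hy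
  have hs := hsx.sub hsy
  set f : ℕ → K := fun j => c j * x ^ j - c j * y ^ j with hf
  have key : ∀ j : ℕ, ‖f (j + 1 + 1)‖ ≤ max ‖x‖ ‖y‖ * ‖x - y‖ := fun j => by
    simp only [hf]
    rw [← mul_sub, norm_mul]
    exact (mul_le_of_le_one_left (norm_nonneg _) (hc _)).trans
      (norm_pow_add_two_sub_pow_le hx.le hy.le j)
  have hr : max ‖x‖ ‖y‖ * ‖x - y‖ < ‖x - y‖ := mul_lt_of_lt_one_left hxy (max_lt hx hy)
  have hlt : ‖∑' j, f (j + 1)‖ < ‖x - y‖ ↔ ‖f (0 + 1)‖ < ‖x - y‖ :=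
    norm_tsum_lt_iff_norm_zero_lt (f := fun j => f (j + 1)) ((summable_nat_add_iff 1).2 hs) hr key
  have h0 : f 0 = 0 := by simp [hf]
  have h1 : f (0 + 1) = c 1 * (x - y) := by simp [hf, mul_sub]
  have hsub : psEval c x - psEval c y = ∑' j, f (j + 1) := by
    rw [psEval, psEval, ← hsx.tsum_sub hsy, ← hf, hs.tsum_eq_zero_add, h0, zero_add]
  rw [hsub, hlt, h1, norm_mul, mul_lt_iff_lt_one_left hxy]

/-- Let `p` be an odd prime, `K` a finite extension of `ℚ_p` with ring of
integers `O = {x | ‖x‖ ≤ 1}` and valuation normalized so that `v_p(p) = 1` (encoded via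
the norm: `v_p(x) > r ↔ ‖x‖ < p^{-r}`).  Let `F ∈ O[[T]]` have vanishing μ-invariant and
λ-invariant `λ(F)`, `F'` its formal derivative, `t₀ ∈ O` with `v_p(t₀) > 0`, and `b ∈ O`
with `v_p(b - t₀) = 1`.  Then the following are equivalent:
(1) `λ(F) > 1`;
(2) `v_p(F(t₀)) > 0` and `v_p(F'(t₀)) > 0`;
(3) `v_p(F(t₀)) > 0` and `v_p(F(b) - F(t₀)) > 1`. -/
theorem statement3
    (p : ℕ) (hp : p.Prime) (hodd : Odd p)
    (K : Type*) [NormedField K] [CompleteSpace K] [IsUltrametricDist K]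
    [hpfact : Fact p.Prime] [Algebra ℚ_[p] K] [FiniteDimensional ℚ_[p] K]
    (hnorm : ∀ x : ℚ_[p], ‖algebraMap ℚ_[p] K x‖ = ‖x‖)
    (c : ℕ → K) (hc : ∀ j, ‖c j‖ ≤ 1) (hμ : ∃ j, ‖c j‖ = 1)
    (t₀ : K) (ht₀ : ‖t₀‖ < 1)
    (b : K) (hbt₀ : ‖b - t₀‖ = (p : ℝ)⁻¹) :
    (1 < lambdaInvariant c ↔ (‖psEval c t₀‖ < 1 ∧ ‖psDerivEval c t₀‖ < 1)) ∧
    (1 < lambdaInvariant c ↔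
      (‖psEval c t₀‖ < 1 ∧ ‖psEval c b - psEval c t₀‖ < (p : ℝ) ^ (-1 : ℤ))) := by
  have hp1 : 1 < (p : ℝ) := mod_cast hp.one_lt
  have hb : ‖b‖ < 1 := by
    have := IsUltrametricDist.norm_add_le_max (b - t₀) t₀
    rw [sub_add_cancel, hbt₀] at this
    exact this.trans_lt (max_lt (inv_lt_one_of_one_lt₀ hp1) ht₀)
  have hpos : 0 < ‖b - t₀‖ := by rw [hbt₀]; positivity
  rw [one_lt_lambdaInvariant_iff hc hμ, norm_psEval_lt_one_iff hc ht₀,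
    norm_psDerivEval_lt_one_iff hc ht₀, zpow_neg_one, ← hbt₀,
    norm_psEval_sub_lt_iff hc hb ht₀ hpos]
  exact ⟨Iff.rfl, Iff.rfl⟩
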